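/- arXiv:2501.07966 — 2 statements merged into one kernel-verified Lean document; each statement's English description precedes it below -/
import Mathlib

section
/- Let x be the horizontal component of the Peano curve. Let p' and q' be positive integers not divisible by 3, p = p'/q', θ ∈ [0,1), n ∈ ℤ, and let k be a positive integer such that p/3^{n-k+1} ≤ 1/3. Then the k-step recursion holds: [x]_1^{p/3^n, θp/3^n} = 3^{-k} Σ_{i_1,…,i_k ∈ {0,1,2}} [x]_1^{(3^k p')/(3^n q'), {θ - Σ_{v=1}^k i_v·3^n q'/(3^v p')}·(3^k p')/(3^n q')} + Σ_{m=1}^k 3^{-(m-1)} Σ_{j_1,…,j_{m-1} ∈ {0,1,2}, j_m ∈ {1,2}} 1_{(0,1)}({θ - Σ_{l=1}^m j_l·3^n q'/(3^l p')})·(3^{m-1} p'/(3^n q'))², where {a} denotes the fractional part of a and 1_{(0,1)} is the indicator of the open interval (0,1). -/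
open scoped BigOperators Classical
open Filter

noncomputable section

/-- The digit map `k n = 2 - n` on `{0,1,2}` (with truncated natural subtraction). -/
def peanoK : ℕ → ℕ := fun n => 2 - n

/-- The `m`-th (0-indexed) ternary digit of the horizontal component of the Peano curve
evaluated at the point with ternary digits `d` (0-indexed, i.e. `t_j = d (j-1)`):
the `j`-th digit of `x(t)` is `k^[t_2 + t_4 + ⋯ + t_{2j-2}] (t_{2j-1})`. -/
def peanoXDigit (d : ℕ → Fin 3) (m : ℕ) : ℕ :=
  peanoK^[∑ i ∈ Finset.range m, (d (2 * i + 1) : ℕ)] (d (2 * m) : ℕ)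

/-- `x : ℝ → ℝ` is (on `[0,1]`) the horizontal component of the Peano curve:
for every ternary expansion `t = Σ_j d_j 3^{-(j+1)}`, `x t` is given by the digit formula. -/
def IsPeanoX (x : ℝ → ℝ) : Prop :=
  ∀ d : ℕ → Fin 3,
    x (∑' j : ℕ, (d j : ℝ) / 3 ^ (j + 1)) = ∑' m : ℕ, (peanoXDigit d m : ℝ) / 3 ^ (m + 1)

/-- The grid `cℤ + r = {cq + r : q ∈ ℤ}`. -/
def peanoGrid (c r : ℝ) : Set ℝ := {u : ℝ | ∃ q : ℤ, u = c * q + r}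

/-- `lebTime x c r m` is the time `t_{m+1}(c,r)` of the Lebesgue partition `π(c,r)` for `x`
on `[0,1]` (values in `[0,1] ∪ {+∞}`, modelled in `EReal`; `sInf ∅ = ⊤ = +∞`). -/
def lebTime (x : ℝ → ℝ) (c r : ℝ) : ℕ → EReal
  | 0 => sInf (Real.toEReal '' {t : ℝ | t ∈ Set.Icc (0 : ℝ) 1 ∧ x t ∈ peanoGrid c r})
  | m + 1 =>
    if lebTime x c r m = ⊤ then ⊤
    else
      sInf (Real.toEReal ''
        {t : ℝ | t ∈ Set.Icc ((lebTime x c r m).toReal) 1 ∧ x t ∈ peanoGrid c r ∧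
          x t ≠ x ((lebTime x c r m).toReal)})

/-- `k(c,r,t) = min{m ∈ ℕ₊ : t_m(c,r) ≥ t}` (recall `t_m(c,r) = lebTime x c r (m-1)`). -/
def kIdx (x : ℝ → ℝ) (c r t : ℝ) : ℕ :=
  sInf {m : ℕ | 1 ≤ m ∧ (t : EReal) ≤ lebTime x c r (m - 1)}

/-- `l(c,r,t) = max{m ∈ ℕ₊ : t_m(c,r) ≤ t}`. -/
def lIdx (x : ℝ → ℝ) (c r t : ℝ) : ℕ :=
  sSup {m : ℕ | 1 ≤ m ∧ lebTime x c r (m - 1) ≤ (t : EReal)}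

/-- The quadratic variation `[x]_{s,t}^{c,r}` of `x` on `[s,t]` along the Lebesgue partition
`π(c,r)`: the sum over `m = k(c,r,s), …, l(c,r,t) - 1` of `(x(t_{m+1}) - x(t_m))²`. -/
def qvar (x : ℝ → ℝ) (c r s t : ℝ) : ℝ :=
  ∑ m ∈ Finset.Ico (kIdx x c r s) (lIdx x c r t),
    (x ((lebTime x c r m).toReal) - x ((lebTime x c r (m - 1)).toReal)) ^ 2

/-- `[x]_t^{c,r} := [x]_{0,t}^{c,r}`. -/
def qvar0 (x : ℝ → ℝ) (c r t : ℝ) : ℝ := qvar x c r 0 t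

lemma peanoK_iterate_lt (v n : ℕ) (hn : n < 3) : peanoK^[v] n < 3 := by
  induction v generalizing n with
  | zero => simpa using hn
  | succ v ih =>
    rw [Function.iterate_succ_apply]
    exact ih _ (by unfold peanoK; omega)

lemma peanoK_iterate_two_sub (v n : ℕ) : peanoK^[v] (2 - n) = 2 - peanoK^[v] n := by
  have := Function.Commute.iterate_self peanoK v n
  simpa [peanoK] using this

lemma peanoK_peanoK (n : ℕ) (hn : n < 3) : peanoK (peanoK n) = n := by
  unfold peanoK
  omega

lemma peanoK_iterate_congr (v w n : ℕ) (hn : n < 3) (h : v % 2 = w % 2) :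
    peanoK^[v] n = peanoK^[w] n := by
  have key : ∀ m : ℕ, peanoK^[2 * m] n = n := by
    intro m
    induction m with
    | zero => rfl
    | succ m ih =>
      rw [show 2 * (m + 1) = 2 * m + 1 + 1 by ring, Function.iterate_succ_apply',
        Function.iterate_succ_apply', ih, peanoK_peanoK n hn]
  rw [← Nat.mod_add_div v 2, ← Nat.mod_add_div w 2, Function.iterate_add_apply,
    Function.iterate_add_apply, key, key, h]

lemma peanoXDigit_lt (d : ℕ → Fin 3) (m : ℕ) : peanoXDigit d m < 3 :=
  peanoK_iterate_lt _ _ (d (2 * m)).isLt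

/-- The ternary digits of `x(t)` as elements of `Fin 3`. -/
def peanoXFin (d : ℕ → Fin 3) (m : ℕ) : Fin 3 := ⟨peanoXDigit d m, peanoXDigit_lt d m⟩

lemma continuous_peanoXFin : Continuous peanoXFin := by
  refine continuous_pi fun m => ?_
  have h : Continuous (fun d : ℕ → Fin 3 => fun i : Fin (2 * m + 1) => d i) := by fun_prop
  let F : (Fin (2 * m + 1) → Fin 3) → Fin 3 := fun e =>
    peanoXFin (fun i => if hi : i < 2 * m + 1 then e ⟨i, hi⟩ else 0) m
  have hF : Continuous F := continuous_of_discreteTopology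
  convert! hF.comp h using 1
  funext d
  simp only [F, Function.comp, peanoXFin, peanoXDigit, Fin.mk.injEq]
  have h1 : ∑ i ∈ Finset.range m, (d (2 * i + 1) : ℕ) = ∑ i ∈ Finset.range m,
      ((if 2 * i + 1 < 2 * m + 1 then d (2 * i + 1) else 0 : Fin 3) : ℕ) := by
    refine Finset.sum_congr rfl fun i hi => ?_
    rw [if_pos (by have := Finset.mem_range.1 hi; omega)]
  rw [h1]
  simp

namespace IsPeanoX

variable {x : ℝ → ℝ}

lemma apply_ofDigits (hx : IsPeanoX x) (d : ℕ → Fin 3) :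
    x (Real.ofDigits d) = Real.ofDigits (peanoXFin d) := by
  have h := hx d
  simpa [Real.ofDigits, Real.ofDigitsTerm, div_eq_mul_inv, peanoXFin] using h

lemma exists_digits {t : ℝ} (ht : t ∈ Set.Icc (0 : ℝ) 1) :
    ∃ d : ℕ → Fin 3, Real.ofDigits d = t := by
  obtain ⟨d, -, hd⟩ := Real.ofDigits_SurjOn (b := 3) (by norm_num) ht
  exact ⟨d, hd⟩

lemma mem_Icc (hx : IsPeanoX x) {t : ℝ} (ht : t ∈ Set.Icc (0 : ℝ) 1) :
    x t ∈ Set.Icc (0 : ℝ) 1 := by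
  obtain ⟨d, rfl⟩ := exists_digits ht
  rw [hx.apply_ofDigits]
  exact ⟨Real.ofDigits_nonneg _, Real.ofDigits_le_one _⟩

lemma continuousOn (hx : IsPeanoX x) : ContinuousOn x (Set.Icc 0 1) := by
  rw [continuousOn_iff_continuous_domRestrict]
  let f : (ℕ → Fin 3) → Set.Icc (0 : ℝ) 1 :=
    fun d => ⟨Real.ofDigits d, Real.ofDigits_nonneg _, Real.ofDigits_le_one _⟩
  have hf : Continuous f := Real.continuous_ofDigits.subtype_mk _
  have hs : Function.Surjective f := by
    rintro ⟨t, ht⟩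
    obtain ⟨d, hd⟩ := exists_digits ht
    exact ⟨d, Subtype.ext hd⟩
  rw [(hf.isClosedMap.isQuotientMap hf hs).continuous_iff]
  have : (Set.Icc 0 1).domRestrict x ∘ f = fun d => Real.ofDigits (peanoXFin d) := by
    funext d
    exact hx.apply_ofDigits d
  rw [this]
  exact Real.continuous_ofDigits.comp continuous_peanoXFin

lemma ofDigits_two_sub (d e : ℕ → Fin 3) (h : ∀ i, (e i : ℕ) = 2 - (d i : ℕ)) :
    Real.ofDigits e = 1 - Real.ofDigits d := by
  rw [eq_sub_iff_add_eq, ← Real.ofDigits_const_last_eq_one 2]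
  unfold Real.ofDigits
  rw [← Real.summable_ofDigitsTerm.tsum_add Real.summable_ofDigitsTerm]
  refine tsum_congr fun i => ?_
  have h2 : ((e i : ℕ) : ℝ) + ((d i : ℕ) : ℝ) = 2 := by
    rw [h i]
    have := (d i).isLt
    push_cast [show (d i : ℕ) ≤ 2 by omega]
    ring
  simp only [Real.ofDigitsTerm, ← add_mul, h2]
  simp

lemma apply_one_sub (hx : IsPeanoX x) {t : ℝ} (ht : t ∈ Set.Icc (0 : ℝ) 1) :
    x (1 - t) = 1 - x t := by
  obtain ⟨d, rfl⟩ := exists_digits ht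
  let e : ℕ → Fin 3 := fun i => ⟨2 - (d i : ℕ), by omega⟩
  rw [← ofDigits_two_sub d e (fun i => rfl), hx.apply_ofDigits, hx.apply_ofDigits]
  refine ofDigits_two_sub _ _ fun m => ?_
  change peanoK^[∑ i ∈ Finset.range m, (2 - (d (2 * i + 1) : ℕ))] (2 - (d (2 * m) : ℕ)) =
    2 - peanoK^[∑ i ∈ Finset.range m, (d (2 * i + 1) : ℕ)] (d (2 * m) : ℕ)
  rw [← peanoK_iterate_two_sub]
  refine peanoK_iterate_congr _ _ _ (by omega) ?_
  rw [Finset.sum_nat_mod, Finset.sum_nat_mod _ _ (fun i => (d (2 * i + 1) : ℕ))]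
  congr 1
  refine Finset.sum_congr rfl fun i _ => ?_
  have := (d (2 * i + 1)).isLt
  omega

lemma ofDigits_eq_head (d : ℕ → Fin 3) :
    Real.ofDigits d = ((d 0 : ℕ) + Real.ofDigits (fun i => d (i + 1))) / 3 := by
  rw [Real.ofDigits_eq_sum_add_ofDigits d 1]
  simp [Real.ofDigitsTerm]
  ring

lemma apply_add_div_nine (hx : IsPeanoX x) {s : ℝ} (hs : s ∈ Set.Icc (0 : ℝ) 1)
    (a b : Fin 3) :
    x ((3 * (a : ℕ) + (b : ℕ) + s) / 9) =
      ((a : ℕ) + (if b = 1 then 1 - x s else x s)) / 3 := by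
  obtain ⟨d, rfl⟩ := exists_digits hs
  let e : ℕ → Fin 3
    | 0 => a
    | 1 => b
    | i + 2 => d i
  have he : Real.ofDigits e = (3 * (a : ℕ) + (b : ℕ) + Real.ofDigits d) / 9 := by
    rw [ofDigits_eq_head, ofDigits_eq_head (fun i => e (i + 1))]
    change ((a : ℕ) + ((b : ℕ) + Real.ofDigits d) / 3) / 3 = _
    ring
  rw [← he, hx.apply_ofDigits, hx.apply_ofDigits, ofDigits_eq_head]
  have h0 : ((peanoXFin e 0 : Fin 3) : ℕ) = a := by simp [peanoXFin, peanoXDigit, e]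
  have hsucc : ∀ m, ((peanoXFin e (m + 1) : Fin 3) : ℕ) =
      peanoK^[(b : ℕ)] (peanoXFin d m : ℕ) := by
    intro m
    simp only [peanoXFin, peanoXDigit]
    rw [Finset.sum_range_succ', add_comm, Function.iterate_add_apply]
    rfl
  rw [h0]
  congr 2
  split_ifs with hb
  · refine ofDigits_two_sub _ _ fun m => ?_
    rw [hsucc, hb]
    rfl
  · congr 1
    funext m
    apply Fin.ext
    rw [hsucc]
    have hm := (peanoXFin d m).isLt
    rcases (by omega : (b : ℕ) = 0 ∨ (b : ℕ) = 1 ∨ (b : ℕ) = 2) with h | h | h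
    · rw [h]; rfl
    · exact absurd (Fin.ext h) hb
    · rw [h]
      exact peanoK_peanoK _ hm

lemma apply_zero (hx : IsPeanoX x) : x 0 = 0 := by
  have h := hx.apply_add_div_nine (s := 0) (by simp) 0 0
  simp at h
  linarith

lemma apply_one (hx : IsPeanoX x) : x 1 = 1 := by
  have h := hx.apply_one_sub (t := 0) (by simp)
  simpa [hx.apply_zero] using h

end IsPeanoX

/-- The times in `[0,1]` at which `x` visits the grid `cℤ + r`. -/
def gridTimes (x : ℝ → ℝ) (c r : ℝ) : Set ℝ :=
  {t : ℝ | t ∈ Set.Icc (0 : ℝ) 1 ∧ x t ∈ peanoGrid c r}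

/-- The position of `x t` in grid units; it is an integer at grid times. -/
def gridIndex (x : ℝ → ℝ) (c r t : ℝ) : ℝ := (x t - r) / c

/-- The number of moves between distinct grid points, as a total variation. -/
def gridVar (x : ℝ → ℝ) (c r : ℝ) : ENNReal :=
  eVariationOn (gridIndex x c r) (gridTimes x c r)

section Grid

variable {x : ℝ → ℝ} {c r : ℝ}

lemma isClosed_subgrid (hc : 0 < c) (A : Set ℤ) :
    IsClosed {u : ℝ | ∃ q ∈ A, u = c * q + r} := by
  have h1 : IsClosed ((fun q : ℤ => (q : ℝ)) '' A) :=
    Int.isClosedEmbedding_coe_real.isClosedMap _ (isClosed_discrete A)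
  have h2 : Continuous fun u : ℝ => (u - r) / c := by fun_prop
  convert h1.preimage h2 using 1
  ext u
  simp only [Set.mem_ofPred_eq, Set.mem_preimage, Set.mem_image]
  refine exists_congr fun q => and_congr_right fun _ => ?_
  rw [eq_div_iff hc.ne']
  constructor <;> intro h <;> linarith

lemma isClosed_peanoGrid (hc : 0 < c) : IsClosed (peanoGrid c r) := by
  simpa [peanoGrid] using isClosed_subgrid (r := r) hc Set.univ

lemma isClosed_peanoGrid_ne (hc : 0 < c) {v : ℝ} (hv : v ∈ peanoGrid c r) :
    IsClosed {u | u ∈ peanoGrid c r ∧ u ≠ v} := by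
  obtain ⟨q₀, rfl⟩ := hv
  convert isClosed_subgrid (r := r) hc {q | q ≠ q₀} using 1
  ext u
  constructor
  · rintro ⟨⟨q, rfl⟩, h⟩
    exact ⟨q, fun hq => h (by rw [hq]), rfl⟩
  · rintro ⟨q, hq, rfl⟩
    refine ⟨⟨q, rfl⟩, fun h => hq ?_⟩
    have h' : c * (q : ℝ) = c * (q₀ : ℝ) := by linarith
    exact_mod_cast mul_left_cancel₀ hc.ne' h'

lemma isCompact_gridTimes (hx : ContinuousOn x (Set.Icc 0 1)) (hc : 0 < c) :
    IsCompact (gridTimes x c r) :=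
  isCompact_Icc.of_isClosed_subset
    (hx.preimage_isClosed_of_isClosed isClosed_Icc (isClosed_peanoGrid hc)) fun _ h => h.1

lemma sInf_coe_eq_top_or {K : Set ℝ} (hK : IsCompact K) :
    (K = ∅ ∧ sInf (Real.toEReal '' K) = ⊤) ∨
      ∃ τ : ℝ, IsLeast K τ ∧ sInf (Real.toEReal '' K) = τ := by
  rcases K.eq_empty_or_nonempty with h | h
  · exact Or.inl ⟨h, by simp [h]⟩
  · obtain ⟨τ, hτ⟩ := hK.exists_isLeast h
    refine Or.inr ⟨τ, hτ, ?_⟩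
    exact (EReal.coe_strictMono.monotone.map_isLeast hτ).isGLB.sInf_eq

lemma lebTime_zero_cases (hx : ContinuousOn x (Set.Icc 0 1)) (hc : 0 < c) :
    (gridTimes x c r = ∅ ∧ lebTime x c r 0 = ⊤) ∨
      ∃ τ : ℝ, IsLeast (gridTimes x c r) τ ∧ lebTime x c r 0 = τ :=
  sInf_coe_eq_top_or (isCompact_gridTimes hx hc)

lemma lebTime_succ_cases (hx : ContinuousOn x (Set.Icc 0 1)) (hc : 0 < c) {m : ℕ} {τ : ℝ}
    (hm : lebTime x c r m = τ) (hτ : τ ∈ gridTimes x c r) :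
    ({t : ℝ | t ∈ Set.Icc τ 1 ∧ x t ∈ peanoGrid c r ∧ x t ≠ x τ} = ∅ ∧
        lebTime x c r (m + 1) = ⊤) ∨
      ∃ τ' : ℝ, IsLeast {t : ℝ | t ∈ Set.Icc τ 1 ∧ x t ∈ peanoGrid c r ∧ x t ≠ x τ} τ' ∧
        lebTime x c r (m + 1) = τ' := by
  have hK : IsCompact {t : ℝ | t ∈ Set.Icc τ 1 ∧ x t ∈ peanoGrid c r ∧ x t ≠ x τ} :=
    isCompact_Icc.of_isClosed_subset
      ((hx.mono (Set.Icc_subset_Icc_left hτ.1.1)).preimage_isClosed_of_isClosed isClosed_Icc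
        (isClosed_peanoGrid_ne hc hτ.2)) fun _ h => h.1
  have hs : lebTime x c r (m + 1) = sInf (Real.toEReal ''
      {t : ℝ | t ∈ Set.Icc τ 1 ∧ x t ∈ peanoGrid c r ∧ x t ≠ x τ}) := by
    simp [lebTime, hm]
  rw [hs]
  exact sInf_coe_eq_top_or hK

/-- A continuous function moving from one grid point to the next distinct one moves by one
grid step. -/
lemma gridIndex_step (hx : ContinuousOn x (Set.Icc 0 1)) (hc : 0 < c) {τ τ' : ℝ}
    (hτ : τ ∈ gridTimes x c r)
    (h : IsLeast {t : ℝ | t ∈ Set.Icc τ 1 ∧ x t ∈ peanoGrid c r ∧ x t ≠ x τ} τ') :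
    |x τ' - x τ| = c := by
  obtain ⟨⟨⟨hle, hle1⟩, ⟨q', hq'⟩, hne⟩, hmin⟩ := h
  obtain ⟨⟨h0, -⟩, q, hq⟩ := hτ
  have hxs : ContinuousOn x (Set.Icc τ τ') := hx.mono (Set.Icc_subset_Icc h0 hle1)
  have key : ∀ p : ℤ, p ≠ q → p ≠ q' → c * (p : ℝ) + r ∉ x '' Set.Icc τ τ' := by
    rintro p hpq hpq' ⟨t, ht, hxt⟩
    have hinj : ∀ p₁ p₂ : ℤ, c * (p₁ : ℝ) + r = c * (p₂ : ℝ) + r → p₁ = p₂ := by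
      intro p₁ p₂ e
      have e' : c * (p₁ : ℝ) = c * (p₂ : ℝ) := by linarith
      exact_mod_cast mul_left_cancel₀ hc.ne' e'
    have hmem : τ' ≤ t := hmin ⟨⟨ht.1, ht.2.trans hle1⟩, ⟨p, hxt⟩, fun e =>
      hpq (hinj _ _ (by rw [← hxt, e, hq]))⟩
    have : t = τ' := le_antisymm ht.2 hmem
    exact hpq' (hinj _ _ (by rw [← hxt, this, hq']))
  have hqq : q' ≠ q := by
    rintro rfl
    exact hne (by rw [hq', hq])
  rcases lt_or_gt_of_ne hqq with hlt | hgt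
  · have hq1 : q' = q - 1 := by
      by_contra hcon
      refine key (q - 1) (by omega) (Ne.symm hcon) (intermediate_value_Icc' hle hxs ?_)
      have h2 : ((q' : ℤ) : ℝ) ≤ ((q - 1 : ℤ) : ℝ) := by exact_mod_cast (by omega)
      have h3 : ((q - 1 : ℤ) : ℝ) ≤ (q : ℝ) := by exact_mod_cast (by omega)
      rw [hq, hq']
      constructor <;> gcongr
    rw [hq', hq, hq1]
    push_cast
    rw [show c * ((q : ℝ) - 1) + r - (c * q + r) = -c by ring, abs_neg, abs_of_pos hc]
  · have hq1 : q' = q + 1 := by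
      by_contra hcon
      refine key (q + 1) (by omega) (Ne.symm hcon) (intermediate_value_Icc hle hxs ?_)
      have h2 : ((q + 1 : ℤ) : ℝ) ≤ (q' : ℝ) := by exact_mod_cast (by omega)
      have h3 : (q : ℝ) ≤ ((q + 1 : ℤ) : ℝ) := by exact_mod_cast (by omega)
      rw [hq, hq']
      constructor <;> gcongr
    rw [hq', hq, hq1]
    push_cast
    rw [show c * ((q : ℝ) + 1) + r - (c * q + r) = c by ring, abs_of_pos hc]

lemma edist_gridIndex (hc : 0 < c) (s t : ℝ) :
    edist (gridIndex x c r s) (gridIndex x c r t) = ENNReal.ofReal (|x t - x s| / c) := by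
  rw [edist_comm, edist_dist, Real.dist_eq, gridIndex, gridIndex, ← sub_div, abs_div,
    abs_of_pos hc]
  congr 3
  ring

lemma exists_lebTime_eq (hx : ContinuousOn x (Set.Icc 0 1)) (hc : 0 < c) (m : ℕ)
    (hm : lebTime x c r m ≠ ⊤) : ∃ τ : ℝ, lebTime x c r m = τ ∧ τ ∈ gridTimes x c r := by
  induction m with
  | zero =>
    rcases lebTime_zero_cases (r := r) hx hc with ⟨-, h⟩ | ⟨τ, hτ, h⟩
    · exact absurd h hm
    · exact ⟨τ, h, hτ.1⟩
  | succ m ih =>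
    have hm' : lebTime x c r m ≠ ⊤ := fun h => hm (by simp [lebTime, h])
    obtain ⟨τ, hτ, hmem⟩ := ih hm'
    rcases lebTime_succ_cases hx hc hτ hmem with ⟨-, h⟩ | ⟨τ', hτ', h⟩
    · exact absurd h hm
    · exact ⟨τ', h, ⟨hmem.1.1.trans hτ'.1.1.1, hτ'.1.1.2⟩, hτ'.1.2.1⟩

lemma eVariationOn_gridIndex_step (hx : ContinuousOn x (Set.Icc 0 1)) (hc : 0 < c) {τ τ' : ℝ}
    (hτ : τ ∈ gridTimes x c r)
    (h : IsLeast {t : ℝ | t ∈ Set.Icc τ 1 ∧ x t ∈ peanoGrid c r ∧ x t ≠ x τ} τ') :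
    eVariationOn (gridIndex x c r) (gridTimes x c r ∩ Set.Icc τ τ') = 1 := by
  have hτ' : τ' ∈ gridTimes x c r := ⟨⟨hτ.1.1.trans h.1.1.1, h.1.1.2⟩, h.1.2.1⟩
  have hlt : τ < τ' := lt_of_le_of_ne h.1.1.1 fun e => h.1.2.2 (by rw [e])
  let φ : ℝ → ℝ := fun t => if t < τ' then τ else τ'
  have hφ : Monotone φ := by
    intro s t hst
    simp only [φ]
    split_ifs <;> linarith
  have hEq : Set.EqOn (gridIndex x c r) (gridIndex x c r ∘ φ)
      (gridTimes x c r ∩ Set.Icc τ τ') := by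
    rintro t ⟨ht, ht'⟩
    simp only [φ, Function.comp]
    split_ifs with h1
    · have : x t = x τ := by
        by_contra hne
        exact absurd (h.2 ⟨⟨ht'.1, ht.1.2⟩, ht.2, hne⟩) (not_le.2 h1)
      simp [gridIndex, this]
    · rw [le_antisymm ht'.2 (not_lt.1 h1)]
  have himg : φ '' (gridTimes x c r ∩ Set.Icc τ τ') = {τ, τ'} := by
    ext t
    constructor
    · rintro ⟨s, -, rfl⟩
      simp only [φ]
      split_ifs <;> simp
    · rintro (rfl | rfl)
      · exact ⟨t, ⟨hτ, le_rfl, hlt.le⟩, by simp [φ, hlt]⟩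
      · exact ⟨t, ⟨hτ', hlt.le, le_rfl⟩, by simp [φ]⟩
  rw [eVariationOn.eq_of_eqOn hEq, eVariationOn.comp_eq_of_monotoneOn _ _ (hφ.monotoneOn _),
    himg, eVariationOn.pair, edist_gridIndex hc, gridIndex_step hx hc hτ h, div_self hc.ne']
  simp

lemma eVariationOn_until_lebTime (hx : ContinuousOn x (Set.Icc 0 1)) (hc : 0 < c) (m : ℕ) :
    ∀ τ : ℝ, lebTime x c r m = τ →
      eVariationOn (gridIndex x c r) (gridTimes x c r ∩ Set.Icc 0 τ) = m := by
  induction m with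
  | zero =>
    intro τ hτ
    rcases lebTime_zero_cases (r := r) hx hc with ⟨-, h⟩ | ⟨τ', h, h'⟩
    · simp [h] at hτ
    · obtain rfl : τ' = τ := by rw [h'] at hτ; exact_mod_cast hτ
      rw [eVariationOn.subsingleton]
      · simp
      · intro s hs t ht
        rw [le_antisymm hs.2.2 (h.2 hs.1), le_antisymm ht.2.2 (h.2 ht.1)]
  | succ m ih =>
    intro τ' hτ'
    obtain ⟨τ, hτ, hmem⟩ := exists_lebTime_eq (r := r) hx hc m
      fun h => by simp [lebTime, h] at hτ'
    rcases lebTime_succ_cases hx hc hτ hmem with ⟨-, h⟩ | ⟨τ'', h, h'⟩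
    · simp [h] at hτ'
    · obtain rfl : τ'' = τ' := by rw [h'] at hτ'; exact_mod_cast hτ'
      rw [← eVariationOn.Icc_add_Icc _ hmem.1.1 h.1.1.1 hmem, ih τ hτ,
        eVariationOn_gridIndex_step hx hc hmem h]
      push_cast
      rfl

lemma exists_lebTime_eq_top (hx : ContinuousOn x (Set.Icc 0 1)) (hc : 0 < c) :
    ∃ m, lebTime x c r m = ⊤ := by
  by_contra! hfin
  choose τ hτ hmem using fun m => exists_lebTime_eq (r := r) hx hc m (hfin m)
  have hsucc : ∀ m, τ m ≤ τ (m + 1) ∧ |x (τ (m + 1)) - x (τ m)| = c := by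
    intro m
    rcases lebTime_succ_cases hx hc (hτ m) (hmem m) with ⟨-, h⟩ | ⟨τ', h, h'⟩
    · exact absurd h (hfin _)
    · obtain rfl : τ' = τ (m + 1) := by
        rw [hτ] at h'
        exact_mod_cast h'.symm
      exact ⟨h.1.1.1, gridIndex_step hx hc (hmem m) h⟩
  have hmono : Monotone τ := monotone_nat_of_le_succ fun m => (hsucc m).1
  have hbdd : BddAbove (Set.range τ) := ⟨1, by rintro _ ⟨m, rfl⟩; exact (hmem m).1.2⟩
  have hlim := tendsto_atTop_ciSup hmono hbdd
  set L := ⨆ m, τ m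
  have hL : L ∈ Set.Icc (0 : ℝ) 1 :=
    isClosed_Icc.mem_of_tendsto hlim (Eventually.of_forall fun m => (hmem m).1)
  have hxlim : Tendsto (fun m => x (τ m)) atTop (nhds (x L)) :=
    (hx L hL).tendsto.comp (tendsto_nhdsWithin_iff.2
      ⟨hlim, Eventually.of_forall fun m => (hmem m).1⟩)
  have hdiff := ((hxlim.comp (tendsto_add_atTop_nat 1)).sub hxlim).abs
  have hconst : Tendsto (fun _ : ℕ => c) atTop (nhds |x L - x L|) :=
    hdiff.congr fun m => (hsucc m).2
  have := tendsto_nhds_unique tendsto_const_nhds hconst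
  simp at this
  exact hc.ne' this

lemma kIdx_zero (hx : ContinuousOn x (Set.Icc 0 1)) (hc : 0 < c) : kIdx x c r 0 = 1 := by
  refine IsLeast.csInf_eq ⟨⟨le_rfl, ?_⟩, fun m hm => hm.1⟩
  by_cases h : lebTime x c r 0 = ⊤
  · simp [h]
  · obtain ⟨τ, hτ, hmem⟩ := exists_lebTime_eq hx hc 0 h
    rw [Nat.sub_self, hτ]
    exact_mod_cast hmem.1.1

/-- The quadratic variation along the Lebesgue partition is `c²` times the number of moves. -/
theorem exists_gridVar_eq (hx : ContinuousOn x (Set.Icc 0 1)) (hc : 0 < c) :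
    ∃ M : ℕ, gridVar x c r = M ∧ qvar0 x c r 1 = c ^ 2 * M := by
  have hex := exists_lebTime_eq_top (r := r) hx hc
  have hspec := Nat.find_spec hex
  have hmin : ∀ m, m < Nat.find hex → lebTime x c r m ≠ ⊤ := fun m => Nat.find_min hex
  generalize Nat.find hex = N at hspec hmin
  have htop : ∀ m, N ≤ m → lebTime x c r m = ⊤ := by
    intro m hm
    induction m, hm using Nat.le_induction with
    | base => exact hspec
    | succ m _ ih => simp [lebTime, ih]
  have hset : {m : ℕ | 1 ≤ m ∧ lebTime x c r (m - 1) ≤ ((1 : ℝ) : EReal)} = Set.Icc 1 N := by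
    ext m
    simp only [Set.mem_ofPred_eq, Set.mem_Icc]
    refine and_congr_right fun h1 => ?_
    constructor
    · intro h
      by_contra hcon
      rw [htop (m - 1) (by omega), top_le_iff] at h
      exact EReal.coe_ne_top _ h
    · intro h
      obtain ⟨τ, hτ, hmem⟩ := exists_lebTime_eq hx hc (m - 1) (hmin _ (by omega))
      rw [hτ]
      exact_mod_cast hmem.1.2
  have hl : lIdx x c r 1 = N := by
    rw [lIdx, hset]
    rcases Nat.eq_zero_or_pos N with rfl | hN
    · simp
    · exact csSup_Icc hN
  refine ⟨N - 1, ?_, ?_⟩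
  · rcases Nat.eq_zero_or_pos N with rfl | hN
    · rcases lebTime_zero_cases (r := r) hx hc with ⟨h, -⟩ | ⟨τ, -, h⟩
      · simp [gridVar, h]
      · simp [h] at hspec
    · obtain ⟨τ, hτ, hmem⟩ := exists_lebTime_eq hx hc (N - 1) (hmin _ (by omega))
      rcases lebTime_succ_cases hx hc hτ hmem with ⟨h, -⟩ | ⟨τ', -, h⟩
      · have hS : gridTimes x c r = gridTimes x c r ∩ Set.Icc 0 1 :=
          (Set.inter_eq_left.2 fun t ht => ht.1).symm
        rw [gridVar, hS, ← eVariationOn.Icc_add_Icc _ hmem.1.1 hmem.1.2 hmem,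
          eVariationOn_until_lebTime hx hc _ τ hτ, eVariationOn.constant_on, add_zero]
        have hconst : ∀ t ∈ gridTimes x c r ∩ Set.Icc τ 1, x t = x τ := by
          intro t ht
          by_contra hne
          exact (h ▸ (⟨ht.2, ht.1.2, hne⟩ : t ∈ {t : ℝ | t ∈ Set.Icc τ 1 ∧
            x t ∈ peanoGrid c r ∧ x t ≠ x τ}) : t ∈ (∅ : Set ℝ))
        rintro _ ⟨s, hs, rfl⟩ _ ⟨t, ht, rfl⟩
        simp [gridIndex, hconst s hs, hconst t ht]
      · rw [Nat.sub_add_cancel hN, hspec] at h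
        exact absurd h.symm (EReal.coe_ne_top _)
  · rw [qvar0, qvar, kIdx_zero hx hc, hl, Finset.sum_congr rfl (g := fun _ => c ^ 2)]
    · simp [mul_comm]
    · intro m hm
      rw [Finset.mem_Ico] at hm
      obtain ⟨τ, hτ, hmem⟩ := exists_lebTime_eq hx hc (m - 1) (hmin _ (by omega))
      rcases lebTime_succ_cases hx hc hτ hmem with ⟨-, h⟩ | ⟨τ', h, h'⟩
      · exact absurd h (hmin _ (by omega))
      · rw [Nat.sub_add_cancel hm.1] at h'
        rw [hτ, h', EReal.toReal_coe, EReal.toReal_coe, ← sq_abs,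
          gridIndex_step hx hc hmem h]

end Grid

lemma qvar0_congr (x : ℝ → ℝ) {c r c' r' : ℝ} (h : peanoGrid c r = peanoGrid c' r') (t : ℝ) :
    qvar0 x c r t = qvar0 x c' r' t := by
  have hleb : lebTime x c r = lebTime x c' r' := by
    funext m
    induction m with
    | zero => simp [lebTime, h]
    | succ m ih => simp [lebTime, h, ih]
  simp [qvar0, qvar, kIdx, lIdx, hleb]

lemma peanoGrid_fract (c u : ℝ) :
    peanoGrid c (Int.fract u * c) = peanoGrid c (u * c) := by
  ext v
  constructor
  · rintro ⟨q, rfl⟩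
    refine ⟨q - ⌊u⌋, ?_⟩
    rw [Int.fract]
    push_cast
    ring
  · rintro ⟨q, rfl⟩
    refine ⟨q + ⌊u⌋, ?_⟩
    rw [Int.fract]
    push_cast
    ring

/-- The parametrization of the ternary interval with first digits `a, b` along which the
horizontal component of the Peano curve is an increasing affine image of itself. -/
def peanoPiece (a b : Fin 3) (s : ℝ) : ℝ :=
  (3 * (a : ℕ) + (b : ℕ) + if b = 1 then 1 - s else s) / 9

lemma peanoPiece_zero (a : Fin 3) (s : ℝ) : peanoPiece a 0 s = (3 * (a : ℕ) + s) / 9 := by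
  simp [peanoPiece]

lemma peanoPiece_one (a : Fin 3) (s : ℝ) : peanoPiece a 1 s = (3 * (a : ℕ) + 2 - s) / 9 := by
  simp [peanoPiece]
  ring

lemma peanoPiece_two (a : Fin 3) (s : ℝ) : peanoPiece a 2 s = (3 * (a : ℕ) + 2 + s) / 9 := by
  rw [peanoPiece, if_neg (by decide)]
  norm_num

lemma exists_peanoPiece_eq {t : ℝ} (ht : t ∈ Set.Icc (0 : ℝ) 1) :
    ∃ a b : Fin 3, ∃ s ∈ Set.Icc (0 : ℝ) 1, peanoPiece a b s = t := by
  have main : ∃ a b : Fin 3, 9 * t - (3 * (a : ℕ) + (b : ℕ)) ∈ Set.Icc (0 : ℝ) 1 := by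
    obtain ⟨i, hi, h⟩ : ∃ i : ℕ, i < 9 ∧ 9 * t - (i : ℝ) ∈ Set.Icc (0 : ℝ) 1 := by
      rcases ht.2.lt_or_eq with h | rfl
      · refine ⟨⌊9 * t⌋₊, ?_, ?_, ?_⟩
        · rw [Nat.floor_lt (by linarith [ht.1])]
          push_cast
          linarith
        · linarith [Nat.floor_le (show 0 ≤ 9 * t by linarith [ht.1])]
        · linarith [Nat.lt_floor_add_one (9 * t)]
      · exact ⟨8, by norm_num, by norm_num⟩
    refine ⟨⟨i / 3, by omega⟩, ⟨i % 3, by omega⟩, ?_⟩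
    have e : (i : ℝ) = 3 * ((i / 3 : ℕ) : ℝ) + ((i % 3 : ℕ) : ℝ) := by
      exact_mod_cast (Nat.div_add_mod i 3).symm
    simpa only [← e] using h
  obtain ⟨a, b, h0, h1⟩ := main
  by_cases hb : b = 1
  · refine ⟨a, b, 1 - (9 * t - (3 * (a : ℕ) + (b : ℕ))), ⟨by linarith, by linarith⟩, ?_⟩
    rw [peanoPiece, if_pos hb]
    ring
  · refine ⟨a, b, 9 * t - (3 * (a : ℕ) + (b : ℕ)), ⟨h0, h1⟩, ?_⟩
    rw [peanoPiece, if_neg hb]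
    ring

lemma peanoPiece_mem_Icc (a b : Fin 3) {s : ℝ} (hs : s ∈ Set.Icc (0 : ℝ) 1) :
    peanoPiece a b s ∈ Set.Icc (((3 * (a : ℕ) + (b : ℕ) : ℕ) : ℝ) / 9)
      (((3 * (a : ℕ) + (b : ℕ) + 1 : ℕ) : ℝ) / 9) := by
  obtain ⟨h0, h1⟩ := hs
  unfold peanoPiece
  push_cast
  split_ifs <;> constructor <;> linarith

lemma peanoPiece_mem_unit (a b : Fin 3) {s : ℝ} (hs : s ∈ Set.Icc (0 : ℝ) 1) :
    peanoPiece a b s ∈ Set.Icc (0 : ℝ) 1 := by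
  refine Set.Icc_subset_Icc (by positivity) ?_ (peanoPiece_mem_Icc a b hs)
  rw [div_le_one (by norm_num)]
  exact_mod_cast (by omega : 3 * (a : ℕ) + (b : ℕ) + 1 ≤ 9)

namespace IsPeanoX

variable {x : ℝ → ℝ} {c r : ℝ}

lemma apply_peanoPiece (hx : IsPeanoX x) (a b : Fin 3) {s : ℝ} (hs : s ∈ Set.Icc (0 : ℝ) 1) :
    x (peanoPiece a b s) = ((a : ℕ) + x s) / 3 := by
  have hs' : 1 - s ∈ Set.Icc (0 : ℝ) 1 := ⟨by linarith [hs.2], by linarith [hs.1]⟩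
  unfold peanoPiece
  split_ifs with hb
  · rw [hx.apply_add_div_nine hs' a b, if_pos hb, hx.apply_one_sub hs]
    ring
  · rw [hx.apply_add_div_nine hs a b, if_neg hb]

lemma gridIndex_peanoPiece (hx : IsPeanoX x) (a b : Fin 3) {s : ℝ}
    (hs : s ∈ Set.Icc (0 : ℝ) 1) :
    gridIndex x c r (peanoPiece a b s) = gridIndex x (3 * c) (3 * r - (a : ℕ)) s := by
  rw [gridIndex, gridIndex, hx.apply_peanoPiece a b hs]
  rw [← mul_div_mul_left _ c (three_ne_zero (α := ℝ))]
  ring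

lemma peanoPiece_mem_gridTimes_iff (hx : IsPeanoX x) (a b : Fin 3) {s : ℝ}
    (hs : s ∈ Set.Icc (0 : ℝ) 1) :
    peanoPiece a b s ∈ gridTimes x c r ↔ s ∈ gridTimes x (3 * c) (3 * r - (a : ℕ)) := by
  simp only [gridTimes, peanoGrid, Set.mem_ofPred_eq, hs, peanoPiece_mem_unit a b hs, true_and,
    hx.apply_peanoPiece a b hs]
  refine exists_congr fun q => ?_
  constructor <;> intro h <;> linarith

lemma eVariationOn_peanoPiece (hx : IsPeanoX x) (a b : Fin 3) :
    eVariationOn (gridIndex x c r)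
      (peanoPiece a b '' gridTimes x (3 * c) (3 * r - (a : ℕ))) =
      gridVar x (3 * c) (3 * r - (a : ℕ)) := by
  rw [gridVar, ← eVariationOn.eq_of_eqOn (f := gridIndex x c r ∘ peanoPiece a b)
    fun s hs => hx.gridIndex_peanoPiece a b hs.1]
  by_cases hb : b = 1
  · refine (eVariationOn.comp_eq_of_antitoneOn _ _ fun s _ t _ hst => ?_).symm
    simp only [peanoPiece, hb, if_true]
    linarith
  · refine (eVariationOn.comp_eq_of_monotoneOn _ _ fun s _ t _ hst => ?_).symm
    simp only [peanoPiece, hb, if_false]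
    linarith

lemma gridTimes_nonempty (hx : IsPeanoX x) (hc : 0 < c) (hc1 : c ≤ 1) :
    (gridTimes x c r).Nonempty := by
  have hmem : c * (⌈-r / c⌉ : ℤ) + r ∈ Set.Icc (x 0) (x 1) := by
    rw [hx.apply_zero, hx.apply_one]
    have h1 := Int.le_ceil (-r / c)
    have h2 := Int.ceil_lt_add_one (-r / c)
    have e : c * (-r / c) = -r := mul_div_cancel₀ _ hc.ne'
    constructor <;> nlinarith
  obtain ⟨t, ht, hxt⟩ := intermediate_value_Icc zero_le_one hx.continuousOn hmem
  exact ⟨t, ht, _, hxt⟩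

lemma apply_lt_of_isLeast (hx : IsPeanoX x) (hc : 0 < c) {m : ℝ}
    (hm : IsLeast (gridTimes x c r) m) : x m < c := by
  by_contra! hcon
  obtain ⟨⟨h01, q, hq⟩, hmin⟩ := hm
  have hmem : x m - c ∈ Set.Icc (x 0) (x m) := by
    rw [hx.apply_zero]
    constructor <;> linarith
  obtain ⟨t, ht, hxt⟩ := intermediate_value_Icc h01.1
    (hx.continuousOn.mono (Set.Icc_subset_Icc_right h01.2)) hmem
  have hle : m ≤ t := hmin ⟨⟨ht.1, ht.2.trans h01.2⟩, q - 1, by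
    rw [hxt, hq]
    push_cast
    ring⟩
  rw [le_antisymm ht.2 hle] at hxt
  linarith

lemma lt_apply_of_isGreatest (hx : IsPeanoX x) (hc : 0 < c) {m : ℝ}
    (hm : IsGreatest (gridTimes x c r) m) : 1 - c < x m := by
  by_contra! hcon
  obtain ⟨⟨h01, q, hq⟩, hmax⟩ := hm
  have hmem : x m + c ∈ Set.Icc (x m) (x 1) := by
    rw [hx.apply_one]
    constructor <;> linarith
  obtain ⟨t, ht, hxt⟩ := intermediate_value_Icc h01.2
    (hx.continuousOn.mono (Set.Icc_subset_Icc_left h01.1)) hmem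
  have hle : t ≤ m := hmax ⟨⟨h01.1.trans ht.1, ht.2⟩, q + 1, by
    rw [hxt, hq]
    push_cast
    ring⟩
  rw [le_antisymm hle ht.1] at hxt
  linarith

/-- The grid times whose first ternary digit is `a`. -/
def gridBlock (x : ℝ → ℝ) (c r : ℝ) (a : Fin 3) : Set ℝ :=
  peanoPiece a 0 '' gridTimes x (3 * c) (3 * r - (a : ℕ)) ∪
    peanoPiece a 1 '' gridTimes x (3 * c) (3 * r - (a : ℕ)) ∪
    peanoPiece a 2 '' gridTimes x (3 * c) (3 * r - (a : ℕ))

lemma gridTimes_eq_gridBlocks (hx : IsPeanoX x) :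
    gridTimes x c r = gridBlock x c r 0 ∪ gridBlock x c r 1 ∪ gridBlock x c r 2 := by
  have hmem : ∀ t, t ∈ gridTimes x c r ↔
      ∃ a b : Fin 3, t ∈ peanoPiece a b '' gridTimes x (3 * c) (3 * r - (a : ℕ)) := by
    intro t
    constructor
    · intro ht
      obtain ⟨a, b, s, hs, rfl⟩ := exists_peanoPiece_eq ht.1
      exact ⟨a, b, s, (hx.peanoPiece_mem_gridTimes_iff a b hs).1 ht, rfl⟩
    · rintro ⟨a, b, s, hs, rfl⟩
      exact (hx.peanoPiece_mem_gridTimes_iff a b hs.1).2 hs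
  ext t
  rw [hmem]
  have hor : ∀ P : Fin 3 → Prop, (∃ a, P a) ↔ P 0 ∨ P 1 ∨ P 2 := fun P =>
    ⟨fun ⟨a, ha⟩ => by fin_cases a <;> simp_all, by
      rintro (h | h | h) <;> exact ⟨_, h⟩⟩
  simp only [gridBlock, hor, Set.mem_union, or_assoc]

lemma isLeast_gridBlock {a : Fin 3} {m : ℝ}
    (hm : IsLeast (gridTimes x (3 * c) (3 * r - (a : ℕ))) m) :
    IsLeast (gridBlock x c r a) (peanoPiece a 0 m) := by
  refine ⟨Or.inl (Or.inl ⟨m, hm.1, rfl⟩), ?_⟩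
  have h1 := hm.1.1.2
  rintro _ ((⟨s, hs, rfl⟩ | ⟨s, hs, rfl⟩) | ⟨s, hs, rfl⟩)
  · have := hm.2 hs
    simp only [peanoPiece_zero]
    linarith
  · have := hs.1.2
    simp only [peanoPiece_zero, peanoPiece_one]
    linarith
  · have := hs.1.1
    simp only [peanoPiece_zero, peanoPiece_two]
    linarith

lemma isGreatest_gridBlock {a : Fin 3} {m : ℝ}
    (hm : IsGreatest (gridTimes x (3 * c) (3 * r - (a : ℕ))) m) :
    IsGreatest (gridBlock x c r a) (peanoPiece a 2 m) := by
  refine ⟨Or.inr ⟨m, hm.1, rfl⟩, ?_⟩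
  have h1 := hm.1.1.1
  rintro _ ((⟨s, hs, rfl⟩ | ⟨s, hs, rfl⟩) | ⟨s, hs, rfl⟩)
  · have := hs.1.2
    simp only [peanoPiece_zero, peanoPiece_two]
    linarith
  · have := hs.1.1
    simp only [peanoPiece_one, peanoPiece_two]
    linarith
  · have := hm.2 hs
    simp only [peanoPiece_two]
    linarith

lemma eVariationOn_gridBlock (hx : IsPeanoX x) {a : Fin 3} {m M : ℝ}
    (hm : IsLeast (gridTimes x (3 * c) (3 * r - (a : ℕ))) m)
    (hM : IsGreatest (gridTimes x (3 * c) (3 * r - (a : ℕ))) M) :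
    eVariationOn (gridIndex x c r) (gridBlock x c r a) =
      3 * gridVar x (3 * c) (3 * r - (a : ℕ)) := by
  have hm01 := hm.1.1
  have hM01 := hM.1.1
  have mono : ∀ b : Fin 3, b ≠ 1 → Monotone (peanoPiece a b) := by
    intro b hb s t hst
    simp only [peanoPiece, hb, if_false]
    linarith
  have anti : Antitone (peanoPiece a 1) := by
    intro s t hst
    simp only [peanoPiece, if_true]
    linarith
  have h01 : IsGreatest (peanoPiece a 0 '' gridTimes x (3 * c) (3 * r - (a : ℕ)) ∪
      peanoPiece a 1 '' gridTimes x (3 * c) (3 * r - (a : ℕ))) (peanoPiece a 1 m) := by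
    refine ⟨Or.inr ⟨m, hm.1, rfl⟩, ?_⟩
    rintro _ (⟨s, hs, rfl⟩ | ⟨s, hs, rfl⟩)
    · have := hs.1.2
      simp only [peanoPiece_zero, peanoPiece_one]
      linarith [hm01.2]
    · exact anti (hm.2 hs)
  rw [gridBlock, eVariationOn.union' _ h01 ((mono 2 (by decide)).map_isLeast hm),
    eVariationOn.union' _ ((mono 0 (by decide)).map_isGreatest hM) (anti.map_isGreatest hM)]
  · simp only [hx.eVariationOn_peanoPiece, hx.gridIndex_peanoPiece _ _ hm01,
      hx.gridIndex_peanoPiece _ _ hM01, edist_self]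
    ring
  · simp only [peanoPiece_zero, peanoPiece_one]
    linarith [hM01.2]
  · simp only [peanoPiece_one, peanoPiece_two]
    linarith [hm01.1]

lemma edist_gridIndex_gridBlock (hx : IsPeanoX x) (hc : 0 < c) {a a' : Fin 3}
    (haa' : (a' : ℕ) = a + 1) {m M : ℝ}
    (hM : IsGreatest (gridTimes x (3 * c) (3 * r - (a : ℕ))) M)
    (hm : IsLeast (gridTimes x (3 * c) (3 * r - (a' : ℕ))) m) :
    edist (gridIndex x c r (peanoPiece a 2 M)) (gridIndex x c r (peanoPiece a' 0 m)) =
      if ((a' : ℕ) : ℝ) / 3 ∈ peanoGrid c r then 0 else 1 := by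
  have hM1 := hx.lt_apply_of_isGreatest (by positivity) hM
  have hM2 := (hx.mem_Icc hM.1.1).2
  have hm1 := hx.apply_lt_of_isLeast (by positivity) hm
  have hm2 := (hx.mem_Icc hm.1.1).1
  obtain ⟨i, hi⟩ := hM.1.2
  obtain ⟨j, hj⟩ := hm.1.2
  rw [hx.gridIndex_peanoPiece a 2 hM.1.1, hx.gridIndex_peanoPiece a' 0 hm.1.1]
  have hgi : gridIndex x (3 * c) (3 * r - (a : ℕ)) M = i := by
    rw [gridIndex, div_eq_iff (by positivity), hi]
    ring
  have hgj : gridIndex x (3 * c) (3 * r - (a' : ℕ)) m = j := by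
    rw [gridIndex, div_eq_iff (by positivity), hj]
    ring
  have ha : ((a' : ℕ) : ℝ) = (a : ℕ) + 1 := by exact_mod_cast haa'
  rw [hgi, hgj]
  -- the common endpoint of the two blocks lies in `[i, i + 1)` and in `(j - 1, j]`
  have hle : i ≤ j := by
    have : c * (i : ℝ) ≤ c * j := by linarith
    exact_mod_cast le_of_mul_le_mul_left this hc
  have hlt : j < i + 2 := by
    have : c * (j : ℝ) < c * ((i + 2 : ℤ) : ℝ) := by
      push_cast
      linarith
    exact_mod_cast lt_of_mul_lt_mul_left this hc.le
  split_ifs with hgrid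
  · obtain ⟨q, hq⟩ := hgrid
    have h1 : q < i + 1 := by
      have : c * (q : ℝ) < c * ((i + 1 : ℤ) : ℝ) := by
        push_cast
        linarith
      exact_mod_cast lt_of_mul_lt_mul_left this hc.le
    have h2 : j < q + 1 := by
      have : c * (j : ℝ) < c * ((q + 1 : ℤ) : ℝ) := by
        push_cast
        linarith
      exact_mod_cast lt_of_mul_lt_mul_left this hc.le
    rw [show i = j by omega, edist_self]
  · have hij : j = i + 1 := by
      rcases (by omega : j = i ∨ j = i + 1) with h | h
      · refine absurd ⟨i, ?_⟩ hgrid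
        rw [h] at hj
        linarith
      · exact h
    rw [hij, edist_dist, Real.dist_eq]
    push_cast
    simp

theorem gridVar_eq (hx : IsPeanoX x) (hc : 0 < c) (hc3 : c ≤ 1 / 3) :
    gridVar x c r = 3 * ∑ a : Fin 3, gridVar x (3 * c) (3 * r - (a : ℕ)) +
      ∑ j : Fin 2, if ((j : ℕ) + 1 : ℝ) / 3 ∈ peanoGrid c r then 0 else 1 := by
  have hne : ∀ a : Fin 3, (gridTimes x (3 * c) (3 * r - (a : ℕ))).Nonempty := fun a =>
    hx.gridTimes_nonempty (by positivity) (by linarith)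
  have hcpt : ∀ a : Fin 3, IsCompact (gridTimes x (3 * c) (3 * r - (a : ℕ))) := fun a =>
    isCompact_gridTimes hx.continuousOn (by positivity)
  choose m hm using fun a => (hcpt a).exists_isLeast (hne a)
  choose M hM using fun a => (hcpt a).exists_isGreatest (hne a)
  have hle : ∀ a a' b b' : Fin 3, a < a' → ∀ s ∈ Set.Icc (0 : ℝ) 1, ∀ t ∈ Set.Icc (0 : ℝ) 1,
      peanoPiece a b s ≤ peanoPiece a' b' t := by
    intro a a' b b' haa' s hs t ht
    refine (peanoPiece_mem_Icc a b hs).2.trans (le_trans ?_ (peanoPiece_mem_Icc a' b' ht).1)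
    gcongr 1
    exact_mod_cast (by omega : 3 * (a : ℕ) + (b : ℕ) + 1 ≤ 3 * (a' : ℕ) + (b' : ℕ))
  have hG01 : IsGreatest (gridBlock x c r 0 ∪ gridBlock x c r 1) (peanoPiece 1 2 (M 1)) := by
    refine ⟨Or.inr (isGreatest_gridBlock (hM 1)).1, ?_⟩
    rintro t (ht | ht)
    · exact ((isGreatest_gridBlock (hM 0)).2 ht).trans
        (hle 0 1 2 2 (by decide) _ (hM 0).1.1 _ (hM 1).1.1)
    · exact (isGreatest_gridBlock (hM 1)).2 ht
  rw [gridVar, hx.gridTimes_eq_gridBlocks,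
    eVariationOn.union' _ hG01 (isLeast_gridBlock (hm 2))
      (hle 1 2 2 0 (by decide) _ (hM 1).1.1 _ (hm 2).1.1),
    eVariationOn.union' _ (isGreatest_gridBlock (hM 0)) (isLeast_gridBlock (hm 1))
      (hle 0 1 2 0 (by decide) _ (hM 0).1.1 _ (hm 1).1.1),
    hx.eVariationOn_gridBlock (hm 0) (hM 0), hx.eVariationOn_gridBlock (hm 1) (hM 1),
    hx.eVariationOn_gridBlock (hm 2) (hM 2),
    hx.edist_gridIndex_gridBlock hc (by rfl) (hM 0) (hm 1),
    hx.edist_gridIndex_gridBlock hc (by rfl) (hM 1) (hm 2)]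
  have h1 : (((0 : Fin 2) : ℕ) + 1 : ℝ) / 3 = (((1 : Fin 3) : ℕ) : ℝ) / 3 := by norm_num
  have h2 : (((1 : Fin 2) : ℕ) + 1 : ℝ) / 3 = (((2 : Fin 3) : ℕ) : ℝ) / 3 := by norm_num
  rw [Fin.sum_univ_three, Fin.sum_univ_two, h1, h2]
  ring

/-- One step of the recursion for the quadratic variation. -/
theorem qvar0_step (hx : IsPeanoX x) (hc : 0 < c) (hc3 : c ≤ 1 / 3) (θ : ℝ) :
    qvar0 x c (θ * c) 1 =
      1 / 3 * ∑ a : Fin 3, qvar0 x (3 * c) ((θ - (a : ℕ) / (3 * c)) * (3 * c)) 1 +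
      ∑ j : Fin 2, (if Int.fract (θ - ((j : ℕ) + 1 : ℝ) / (3 * c)) ∈ Set.Ioo (0 : ℝ) 1
        then (1 : ℝ) else 0) * c ^ 2 := by
  obtain ⟨N, hN, hq⟩ := exists_gridVar_eq (r := θ * c) hx.continuousOn hc
  choose N' hN' hq' using fun a : Fin 3 => exists_gridVar_eq (c := 3 * c)
    (r := (θ - (a : ℕ) / (3 * c)) * (3 * c)) hx.continuousOn (by positivity)
  have hr : ∀ a : Fin 3, 3 * (θ * c) - (a : ℕ) = (θ - (a : ℕ) / (3 * c)) * (3 * c) := by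
    intro a
    field_simp
  have hind : ∀ j : Fin 2, ((j : ℕ) + 1 : ℝ) / 3 ∈ peanoGrid c (θ * c) ↔
      Int.fract (θ - ((j : ℕ) + 1 : ℝ) / (3 * c)) ∉ Set.Ioo (0 : ℝ) 1 := by
    intro j
    simp only [Set.mem_Ioo, Int.fract_lt_one, and_true, not_lt]
    rw [(Int.fract_nonneg _).ge_iff_eq', Int.fract_eq_iff]
    simp only [le_refl, zero_lt_one, true_and, sub_zero]
    constructor
    · rintro ⟨q, h⟩
      refine ⟨-q, ?_⟩
      rw [← div_div, h]
      field_simp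
      push_cast
      ring
    · rintro ⟨q, h⟩
      refine ⟨-q, ?_⟩
      rw [sub_eq_iff_eq_add'] at h
      rw [h]
      field_simp
      push_cast
      ring
  have h := hx.gridVar_eq (r := θ * c) hc hc3
  simp only [hr, hN, hN', hind] at h
  have h' : (N : ℝ) = 3 * ∑ a : Fin 3, (N' a : ℝ) +
      ∑ j : Fin 2, if Int.fract (θ - ((j : ℕ) + 1 : ℝ) / (3 * c)) ∈ Set.Ioo (0 : ℝ) 1
        then (1 : ℝ) else 0 := by
    have h3 : (N : ENNReal) = ((3 * ∑ a : Fin 3, N' a + ∑ j : Fin 2,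
        if Int.fract (θ - ((j : ℕ) + 1 : ℝ) / (3 * c)) ∈ Set.Ioo (0 : ℝ) 1
          then 1 else 0 : ℕ) : ENNReal) := by
      rw [h]
      simp only [ite_not]
      push_cast
      rfl
    have h4 : N = _ := Nat.cast_injective h3
    rw [h4]
    push_cast
    rfl
  simp only [hq, hq']
  rw [h', ← Finset.mul_sum, ← Finset.sum_mul]
  ring

end IsPeanoX

lemma sum_fin_succ_fun_eq_sum_snoc {M : Type*} [AddCommMonoid M] {k : ℕ} {α : Type*} [Fintype α]
    (f : (Fin (k + 1) → α) → M) :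
    ∑ i : Fin (k + 1) → α, f i =
      ∑ i : Fin k → α, ∑ a : α, f (Fin.snoc (α := fun _ => α) i a) := by
  rw [← (Fin.snocEquiv fun _ : Fin (k + 1) => α).sum_comp, Fintype.sum_prod_type_right]
  rfl

namespace IsPeanoX

variable {x : ℝ → ℝ} {c : ℝ}

/-- The iterated recursion for the quadratic variation, in terms of the mesh `c` alone. -/
theorem qvar0_iterate (hx : IsPeanoX x) (hc : 0 < c) (θ : ℝ) (k : ℕ) (hk : 3 ^ k * c ≤ 1) :
    qvar0 x c (θ * c) 1 =
      1 / 3 ^ k * ∑ i : Fin k → Fin 3, qvar0 x (3 ^ k * c)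
        ((θ - ∑ v : Fin k, (i v : ℝ) * (1 / (3 ^ ((v : ℕ) + 1) * c))) * (3 ^ k * c)) 1 +
      ∑ m ∈ Finset.range k, 1 / 3 ^ m * ∑ j : Fin m → Fin 3, ∑ jm : Fin 2,
        (if Int.fract (θ - (∑ l : Fin m, (j l : ℝ) * (1 / (3 ^ ((l : ℕ) + 1) * c)) +
            ((jm : ℕ) + 1 : ℝ) * (1 / (3 ^ (m + 1) * c)))) ∈ Set.Ioo (0 : ℝ) 1
          then (1 : ℝ) else 0) * (3 ^ m * c) ^ 2 := by
  induction k with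
  | zero => simp
  | succ k ih =>
    have hk3 : 3 ^ k * c ≤ 1 / 3 := by
      rw [pow_succ] at hk
      linarith
    rw [ih (by linarith), Finset.sum_range_succ, add_comm (Finset.sum _ _), ← add_assoc]
    congr 1
    simp only [hx.qvar0_step (show 0 < 3 ^ k * c by positivity) hk3]
    rw [Finset.sum_add_distrib, mul_add, sum_fin_succ_fun_eq_sum_snoc]
    congr 1
    · rw [← Finset.mul_sum, ← mul_assoc]
      congr 1
      · rw [pow_succ]
        field_simp
      · refine Finset.sum_congr rfl fun i _ => Finset.sum_congr rfl fun a _ => ?_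
        have h3 : 3 * (3 ^ k * c) = 3 ^ (k + 1) * c := by ring
        simp only [h3, Fin.sum_univ_castSucc, Fin.snoc_castSucc, Fin.snoc_last, Fin.val_castSucc,
          Fin.val_last]
        rw [← sub_sub, mul_one_div]
    · congr 1
      refine Finset.sum_congr rfl fun i _ => Finset.sum_congr rfl fun a _ => ?_
      have h3 : 3 * (3 ^ k * c) = 3 ^ (k + 1) * c := by ring
      rw [h3, sub_sub, mul_one_div]

end IsPeanoX

/-- The `k`-step recursion for the quadratic variation of the horizontal component of the
Peano curve along the Lebesgue partitions for the grids `(p/3^n)ℤ + (θp/3^n)`. -/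
theorem peano_k_step_recursion (x : ℝ → ℝ) (hx : IsPeanoX x)
    (p' q' : ℕ) (hp'pos : 0 < p') (hq'pos : 0 < q')
    (hp'3 : ¬ (3 ∣ p')) (hq'3 : ¬ (3 ∣ q'))
    (θ : ℝ) (hθ : θ ∈ Set.Ico (0 : ℝ) 1)
    (n : ℤ) (k : ℕ) (hk : 0 < k)
    (hkn : ((p' : ℝ) / (q' : ℝ)) / (3 : ℝ) ^ (n - (k : ℤ) + 1) ≤ 1 / 3) :
    qvar0 x (((p' : ℝ) / (q' : ℝ)) / (3 : ℝ) ^ n) (θ * ((p' : ℝ) / (q' : ℝ)) / (3 : ℝ) ^ n) 1 =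
      (1 / (3 : ℝ) ^ k) * ∑ i : Fin k → Fin 3,
        qvar0 x (((3 : ℝ) ^ k * (p' : ℝ)) / ((3 : ℝ) ^ n * (q' : ℝ)))
          (Int.fract (θ - ∑ v : Fin k,
              (i v : ℝ) * ((3 : ℝ) ^ n * (q' : ℝ) / ((3 : ℝ) ^ ((v : ℕ) + 1) * (p' : ℝ)))) *
            (((3 : ℝ) ^ k * (p' : ℝ)) / ((3 : ℝ) ^ n * (q' : ℝ)))) 1 +
      ∑ m ∈ Finset.Icc 1 k, (1 / (3 : ℝ) ^ (m - 1)) *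
        ∑ j : Fin (m - 1) → Fin 3, ∑ jm : Fin 2,
          (if Int.fract (θ - (∑ l : Fin (m - 1),
                (j l : ℝ) * ((3 : ℝ) ^ n * (q' : ℝ) / ((3 : ℝ) ^ ((l : ℕ) + 1) * (p' : ℝ))) +
                ((jm : ℕ) + 1 : ℝ) * ((3 : ℝ) ^ n * (q' : ℝ) / ((3 : ℝ) ^ m * (p' : ℝ)))))
              ∈ Set.Ioo (0 : ℝ) 1 then (1 : ℝ) else 0) *
            (((3 : ℝ) ^ (m - 1) * (p' : ℝ)) / ((3 : ℝ) ^ n * (q' : ℝ))) ^ 2 := by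
  set c : ℝ := ((p' : ℝ) / (q' : ℝ)) / (3 : ℝ) ^ n with hcdef
  have hp : (0 : ℝ) < p' := by exact_mod_cast hp'pos
  have hq : (0 : ℝ) < q' := by exact_mod_cast hq'pos
  have h3n : (0 : ℝ) < (3 : ℝ) ^ n := by positivity
  have hc : 0 < c := by positivity
  have hmesh : ∀ m : ℕ, ((3 : ℝ) ^ m * (p' : ℝ)) / ((3 : ℝ) ^ n * (q' : ℝ)) = 3 ^ m * c := by
    intro m
    rw [hcdef]
    field_simp
  have hinv : ∀ m : ℕ, (3 : ℝ) ^ n * (q' : ℝ) / ((3 : ℝ) ^ m * (p' : ℝ)) =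
      1 / (3 ^ m * c) := by
    intro m
    rw [← hmesh, one_div_div]
  have hkc : 3 ^ k * c ≤ 1 := by
    have h1 : ((p' : ℝ) / (q' : ℝ)) / (3 : ℝ) ^ (n - (k : ℤ) + 1) = 3 ^ k * c / 3 := by
      rw [hcdef, zpow_add₀ (by norm_num), zpow_sub₀ (by norm_num), zpow_one, zpow_natCast]
      field_simp
    rw [h1] at hkn
    linarith
  rw [mul_div_assoc, ← hcdef, hx.qvar0_iterate hc θ k hkc]
  simp only [hmesh, hinv]
  congr 1
  · congr 1
    refine Finset.sum_congr rfl fun i _ => qvar0_congr x (peanoGrid_fract _ _).symm 1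
  · refine Finset.sum_nbij' (· + 1) (· - 1) ?_ ?_ ?_ ?_ fun m _ => rfl
    all_goals
      intro m hm
      simp only [Finset.mem_range, Finset.mem_Icc] at hm ⊢
      omega
end
end

section
/- Let x be the horizontal component of the Peano curve. For every c ∈ (1/3, 1] and every r ∈ [0, c), the quadratic variation [x]_1^{c,r} along the Lebesgue partition π(c,r) belongs to {0, c², 2c²}, and for w ∈ {0,1,2} one has [x]_1^{c,r} = w·c² if and only if w·c + r ≤ 1 and (w+1)·c + r > 1. -/
open scoped BigOperators Classical
open Filter

noncomputable section

lemma peanoK_iterate_le (v : ℕ) {n : ℕ} (hn : n ≤ 2) : peanoK^[v] n ≤ 2 := by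
  cases v with
  | zero => simpa using hn
  | succ v =>
    rw [Function.iterate_succ_apply']
    exact Nat.sub_le _ _

/-- The digit sequence of `x t` as a function of the digit sequence of `t`. -/
def peanoXDigits (d : ℕ → Fin 3) (m : ℕ) : Fin 3 := Fin.ofNat 3 (peanoXDigit d m)

lemma peanoXDigits_val (d : ℕ → Fin 3) (m : ℕ) : (peanoXDigits d m : ℕ) = peanoXDigit d m :=
  Nat.mod_eq_of_lt (peanoXDigit_lt d m)

lemma peanoXDigits_zero (d : ℕ → Fin 3) : peanoXDigits d 0 = d 0 := by
  apply Fin.ext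
  rw [peanoXDigits_val]
  simp [peanoXDigit]

lemma continuous_peanoXDigits : Continuous peanoXDigits := by
  refine continuous_pi fun m => ?_
  have h : Continuous fun d : ℕ → Fin 3 =>
      (∑ i ∈ Finset.range m, (d (2 * i + 1) : ℕ), d (2 * m)) := by
    refine Continuous.prodMk (continuous_finsetSum _ fun i _ => ?_) (continuous_apply _)
    exact continuous_of_discreteTopology.comp (continuous_apply (2 * i + 1))
  exact (continuous_of_discreteTopology (f := fun p : ℕ × Fin 3 =>
    Fin.ofNat 3 (peanoK^[p.1] (p.2 : ℕ)))).comp h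

lemma IsPeanoX.apply_ofDigits_s12 {x : ℝ → ℝ} (hx : IsPeanoX x) (d : ℕ → Fin 3) :
    x (Real.ofDigits d) = Real.ofDigits (peanoXDigits d) := by
  have h := hx d
  simpa only [Real.ofDigits, Real.ofDigitsTerm, peanoXDigits_val, div_eq_mul_inv,
    Nat.cast_ofNat] using h

lemma exists_ofDigits_eq {t : ℝ} (ht : t ∈ Set.Icc (0 : ℝ) 1) :
    ∃ d : ℕ → Fin 3, Real.ofDigits d = t := by
  obtain ⟨d, -, hd⟩ := Real.ofDigits_SurjOn (b := 3) (by norm_num) ht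
  exact ⟨d, hd⟩

lemma IsPeanoX.continuousOn_s12 {x : ℝ → ℝ} (hx : IsPeanoX x) :
    ContinuousOn x (Set.Icc 0 1) := by
  rw [continuousOn_iff_continuous_domRestrict]
  let φ : (ℕ → Fin 3) → Set.Icc (0 : ℝ) 1 := fun d =>
    ⟨Real.ofDigits d, Real.ofDigits_nonneg d, Real.ofDigits_le_one d⟩
  have hφ : Continuous φ := Real.continuous_ofDigits.subtype_mk _
  have hsurj : Function.Surjective φ := fun t => by
    obtain ⟨d, hd⟩ := exists_ofDigits_eq t.2
    exact ⟨d, Subtype.ext hd⟩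
  rw [(hφ.isClosedMap.isQuotientMap hφ hsurj).continuous_iff]
  have h : (Set.Icc (0 : ℝ) 1).domRestrict x ∘ φ = fun d => Real.ofDigits (peanoXDigits d) :=
    funext hx.apply_ofDigits_s12
  rw [h]
  exact Real.continuous_ofDigits.comp continuous_peanoXDigits

lemma IsPeanoX.mem_Icc_s12 {x : ℝ → ℝ} (hx : IsPeanoX x) {t : ℝ} (ht : t ∈ Set.Icc (0 : ℝ) 1) :
    x t ∈ Set.Icc (0 : ℝ) 1 := by
  obtain ⟨d, rfl⟩ := exists_ofDigits_eq ht
  rw [hx.apply_ofDigits_s12]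
  exact ⟨Real.ofDigits_nonneg _, Real.ofDigits_le_one _⟩

lemma IsPeanoX.apply_one_s12 {x : ℝ → ℝ} (hx : IsPeanoX x) : x 1 = 1 := by
  have h1 : Real.ofDigits (fun _ => Fin.last 2) = 1 := by
    simpa using Real.ofDigits_const_last_eq_one 2
  have h2 : peanoXDigits (fun _ => Fin.last 2) = fun _ => Fin.last 2 := by
    funext m
    apply Fin.ext
    rw [peanoXDigits_val]
    have h : Function.IsPeriodicPt peanoK 2 2 := rfl
    simp only [peanoXDigit, Finset.sum_const, Finset.card_range, smul_eq_mul, Fin.val_last]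
    exact h.const_mul m
  have h3 := hx.apply_ofDigits_s12 fun _ => Fin.last 2
  rwa [h2, h1] at h3

lemma IsPeanoX.apply_zero_s12 {x : ℝ → ℝ} (hx : IsPeanoX x) : x 0 = 0 := by
  have h1 : Real.ofDigits (fun _ => (0 : Fin 3)) = 0 := by
    simp [Real.ofDigits, Real.ofDigitsTerm]
  have h2 : peanoXDigits (fun _ => (0 : Fin 3)) = fun _ => 0 := by
    funext m
    apply Fin.ext
    rw [peanoXDigits_val]
    simp [peanoXDigit]
  have h3 := hx.apply_ofDigits_s12 fun _ => (0 : Fin 3)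
  rwa [h2, h1] at h3

lemma ofDigits_mem_Icc_first_digit (d : ℕ → Fin 3) :
    Real.ofDigits d ∈ Set.Icc ((d 0 : ℝ) / 3) (((d 0 : ℝ) + 1) / 3) := by
  have h := Real.ofDigits_eq_sum_add_ofDigits d 1
  have h0 := Real.ofDigits_nonneg fun i => d (i + 1)
  have h1 := Real.ofDigits_le_one fun i => d (i + 1)
  simp only [Finset.sum_range_one, Real.ofDigitsTerm, Nat.cast_ofNat, zero_add, pow_one] at h
  constructor <;> linarith

/-- Looking forward in time, the horizontal component never drops by more than `1/3`. -/
lemma IsPeanoX.sub_le {x : ℝ → ℝ} (hx : IsPeanoX x) {s t : ℝ} (hs : s ∈ Set.Icc (0 : ℝ) 1)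
    (ht : t ∈ Set.Icc (0 : ℝ) 1) (hst : s ≤ t) : x s - 1 / 3 ≤ x t := by
  obtain ⟨d, rfl⟩ := exists_ofDigits_eq hs
  obtain ⟨e, rfl⟩ := exists_ofDigits_eq ht
  rcases le_or_gt (d 0) (e 0) with h | h
  · have hd := (ofDigits_mem_Icc_first_digit (peanoXDigits d)).2
    have he := (ofDigits_mem_Icc_first_digit (peanoXDigits e)).1
    rw [peanoXDigits_zero, ← hx.apply_ofDigits_s12] at hd he
    have h' : ((d 0 : ℕ) : ℝ) ≤ ((e 0 : ℕ) : ℝ) := by exact_mod_cast h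
    linarith
  · have hd := (ofDigits_mem_Icc_first_digit d).1
    have he := (ofDigits_mem_Icc_first_digit e).2
    have h' : ((e 0 : ℕ) : ℝ) + 1 ≤ ((d 0 : ℕ) : ℝ) := by exact_mod_cast h
    rw [le_antisymm hst (by linarith)]
    linarith

/-- First passage time after `a` of a continuous function at a level between `x a` and `x 1`. -/
lemma exists_first_passage {x : ℝ → ℝ} (hx : ContinuousOn x (Set.Icc 0 1)) {a p : ℝ}
    (ha : a ∈ Set.Icc (0 : ℝ) 1) (hap : x a ≤ p) (hp : p ≤ x 1) :
    ∃ τ ∈ Set.Icc a 1, x τ = p ∧ ∀ t ∈ Set.Icc a 1, p ≤ x t → τ ≤ t := by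
  have hx' : ContinuousOn x (Set.Icc a 1) := hx.mono (Set.Icc_subset_Icc_left ha.1)
  have hpassage : ∀ t ∈ Set.Icc a 1, p ≤ x t → ∃ u ∈ Set.Icc a t, x u = p := fun t ht hpt =>
    intermediate_value_Icc ht.1 (hx'.mono (Set.Icc_subset_Icc_right ht.2)) ⟨hap, hpt⟩
  have hcompact : IsCompact (Set.Icc a 1 ∩ x ⁻¹' {p}) :=
    isCompact_Icc.of_isClosed_subset (hx'.preimage_isClosed_of_isClosed isClosed_Icc
      isClosed_singleton) Set.inter_subset_left
  obtain ⟨u, hu, hup⟩ := hpassage 1 (Set.right_mem_Icc.2 ha.2) hp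
  obtain ⟨τ, ⟨hτ, hτp⟩, hmin⟩ := hcompact.exists_isLeast ⟨u, hu, hup⟩
  refine ⟨τ, hτ, hτp, fun t ht hpt => ?_⟩
  obtain ⟨v, hv, hvp⟩ := hpassage t ht hpt
  exact (hmin ⟨⟨hv.1, hv.2.trans ht.2⟩, hvp⟩).trans hv.2

lemma sInf_toEReal_image_of_isLeast {S : Set ℝ} {τ : ℝ} (h : IsLeast S τ) :
    sInf (Real.toEReal '' S) = (τ : EReal) :=
  (EReal.coe_strictMono.monotone.map_isLeast h).isGLB.sInf_eq

/-- A grid point strictly above `c * (n - 1) + r` is at least `c * n + r`. -/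
lemma le_of_mem_peanoGrid {c r u : ℝ} (hc : 0 < c) {n : ℤ} (hu : u ∈ peanoGrid c r)
    (h : c * (n - 1) + r < u) : c * n + r ≤ u := by
  obtain ⟨q, rfl⟩ := hu
  have hq : (n : ℝ) - 1 < q := lt_of_mul_lt_mul_left (by linarith) hc.le
  have hq' : n ≤ q := by
    have : n - 1 < q := by exact_mod_cast hq
    omega
  have : (n : ℝ) ≤ q := by exact_mod_cast hq'
  gcongr

/-- After a visit to the level `c * m + r`, any grid value that differs from it is at least the
next level. -/
lemma IsPeanoX.next_level_le {x : ℝ → ℝ} (hx : IsPeanoX x) {c r : ℝ} (hc : 1 / 3 < c) {m : ℕ}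
    {τ t : ℝ} (hτ : τ ∈ Set.Icc (0 : ℝ) 1) (hxτ : x τ = c * m + r) (ht : t ∈ Set.Icc τ 1)
    (hgrid : x t ∈ peanoGrid c r) (hne : x t ≠ x τ) : c * (m + 1 : ℕ) + r ≤ x t := by
  have hc0 : 0 < c := by linarith
  have hdrop := hx.sub_le hτ ⟨hτ.1.trans ht.1, ht.2⟩ ht.1
  have h1 : c * m + r ≤ x t := by
    have := le_of_mem_peanoGrid hc0 (n := (m : ℤ)) hgrid (by push_cast; linarith)
    simpa using this
  have h2 : c * m + r < x t := lt_of_le_of_ne h1 fun h => hne (by rw [hxτ, h])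
  have := le_of_mem_peanoGrid hc0 (n := (m : ℤ) + 1) hgrid (by push_cast; linarith)
  simpa using this

lemma IsPeanoX.lebTime_eq {x : ℝ → ℝ} (hx : IsPeanoX x) {c r : ℝ} (hc : 1 / 3 < c)
    (hr : r ∈ Set.Ico 0 c) (m : ℕ) (hm : c * m + r ≤ 1) :
    ∃ τ ∈ Set.Icc (0 : ℝ) 1, lebTime x c r m = τ ∧ x τ = c * m + r := by
  have hc0 : 0 < c := by linarith
  induction m with
  | zero =>
    obtain ⟨τ, hτ, hxτ, hmin⟩ := exists_first_passage hx.continuousOn_s12 (a := 0) (p := r)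
      (by simp) (by simpa [hx.apply_zero_s12] using hr.1) (by simpa [hx.apply_one_s12] using hm)
    refine ⟨τ, hτ, ?_, by simpa using hxτ⟩
    rw [lebTime]
    refine sInf_toEReal_image_of_isLeast ⟨⟨hτ, 0, by simpa using hxτ⟩, fun t ht => ?_⟩
    have h0 := (hx.mem_Icc_s12 ht.1).1
    have := le_of_mem_peanoGrid hc0 (n := 0) ht.2 (by push_cast; linarith [hr.2])
    exact hmin t ht.1 (by simpa using this)
  | succ m ih =>
    have hlevel : c * (m : ℝ) + r < c * (m + 1 : ℕ) + r := by push_cast; linarith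
    obtain ⟨σ, hσ, hlebσ, hxσ⟩ := ih (hlevel.le.trans hm)
    obtain ⟨τ, hτ, hxτ, hmin⟩ := exists_first_passage hx.continuousOn_s12 hσ
      (hxσ.trans_le hlevel.le) (hm.trans_eq hx.apply_one_s12.symm)
    refine ⟨τ, ⟨hσ.1.trans hτ.1, hτ.2⟩, ?_, hxτ⟩
    rw [lebTime, hlebσ, if_neg (EReal.coe_ne_top σ), EReal.toReal_coe]
    refine sInf_toEReal_image_of_isLeast ⟨⟨hτ, ⟨(m + 1 : ℕ), ?_⟩, ?_⟩, fun t ht => ?_⟩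
    · rw [hxτ, Int.cast_natCast]
    · rw [hxτ, hxσ]
      exact hlevel.ne'
    · exact hmin t ht.1 (hx.next_level_le hc hσ hxσ ht.1 ht.2.1 ht.2.2)

lemma IsPeanoX.lebTime_eq_top {x : ℝ → ℝ} (hx : IsPeanoX x) {c r : ℝ} (hc : 1 / 3 < c)
    (hr : r ∈ Set.Ico 0 c) {w m : ℕ} (hw : c * w + r ≤ 1) (hw' : 1 < c * (w + 1 : ℕ) + r)
    (hm : w < m) : lebTime x c r m = ⊤ := by
  induction m, hm using Nat.le_induction with
  | base =>
    obtain ⟨σ, hσ, hlebσ, hxσ⟩ := hx.lebTime_eq hc hr w hw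
    rw [Nat.succ_eq_add_one, lebTime, hlebσ, if_neg (EReal.coe_ne_top σ), EReal.toReal_coe]
    refine sInf_eq_top.2 ?_
    rintro _ ⟨t, ht, rfl⟩
    have h1 := hx.next_level_le hc hσ hxσ ht.1 ht.2.1 ht.2.2
    have h2 := (hx.mem_Icc_s12 ⟨hσ.1.trans ht.1.1, ht.1.2⟩).2
    linarith
  | succ m _ ih => rw [lebTime, if_pos ih]

/-- If exactly the levels `r, c + r, …, c * w + r` lie in `[0,1]`, each is visited once, in
increasing order. -/
lemma IsPeanoX.qvar0_one_eq {x : ℝ → ℝ} (hx : IsPeanoX x) {c r : ℝ} (hc : 1 / 3 < c)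
    (hr : r ∈ Set.Ico 0 c) {w : ℕ} (hw : c * w + r ≤ 1) (hw' : 1 < c * (w + 1 : ℕ) + r) :
    qvar0 x c r 1 = w * c ^ 2 := by
  have hlevel : ∀ m ≤ w, c * (m : ℝ) + r ≤ 1 := fun m hm => by
    have : (m : ℝ) ≤ w := by exact_mod_cast hm
    have : c * (m : ℝ) ≤ c * w := mul_le_mul_of_nonneg_left this (by linarith)
    linarith
  have hk : kIdx x c r 0 = 1 := by
    obtain ⟨τ, hτ, hleb, -⟩ := hx.lebTime_eq hc hr 0 (hlevel 0 (Nat.zero_le w))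
    have hmem : 1 ∈ {m : ℕ | 1 ≤ m ∧ ((0 : ℝ) : EReal) ≤ lebTime x c r (m - 1)} := by
      refine ⟨le_rfl, ?_⟩
      rw [Nat.sub_self, hleb]
      exact EReal.coe_le_coe_iff.2 hτ.1
    exact le_antisymm (Nat.sInf_le hmem) (Nat.sInf_mem ⟨1, hmem⟩).1
  have hl : lIdx x c r 1 = w + 1 := by
    refine IsGreatest.csSup_eq ⟨⟨Nat.le_add_left 1 w, ?_⟩, fun m hm => ?_⟩
    · obtain ⟨τ, hτ, hleb, -⟩ := hx.lebTime_eq hc hr w hw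
      rw [Nat.add_sub_cancel, hleb]
      exact EReal.coe_le_coe_iff.2 hτ.2
    · by_contra! hlt
      have hle := hm.2
      rw [hx.lebTime_eq_top hc hr hw hw' (by omega), top_le_iff] at hle
      exact EReal.coe_ne_top 1 hle
  have hvalue : ∀ m ≤ w, x (lebTime x c r m).toReal = c * m + r := fun m hm => by
    obtain ⟨τ, -, hleb, hxτ⟩ := hx.lebTime_eq hc hr m (hlevel m hm)
    rw [hleb, EReal.toReal_coe, hxτ]
  rw [qvar0, qvar, hk, hl]
  have hterm : ∀ m ∈ Finset.Ico 1 (w + 1),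
      (x (lebTime x c r m).toReal - x (lebTime x c r (m - 1)).toReal) ^ 2 = c ^ 2 := by
    intro m hm
    rw [Finset.mem_Ico] at hm
    rw [hvalue m (by omega), hvalue (m - 1) (by omega), Nat.cast_sub hm.1]
    push_cast
    ring
  rw [Finset.sum_congr rfl hterm]
  simp

/-- For `c ∈ (1/3, 1]` and `r ∈ [0, c)`, the quadratic variation `[x]_1^{c,r}` of the
horizontal component of the Peano curve belongs to `{0, c², 2c²}`, and for `w ∈ {0,1,2}`,
`[x]_1^{c,r} = w c²` holds if and only if `w c + r ≤ 1` and `(w+1) c + r > 1`. -/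
theorem peano_qvar_coarse_grid (x : ℝ → ℝ) (hx : IsPeanoX x)
    (c r : ℝ) (hc : c ∈ Set.Ioc (1 / 3 : ℝ) 1) (hr : r ∈ Set.Ico (0 : ℝ) c) :
    qvar0 x c r 1 ∈ ({0, c ^ 2, 2 * c ^ 2} : Set ℝ) ∧
    ∀ w : ℕ, w ≤ 2 →
      (qvar0 x c r 1 = (w : ℝ) * c ^ 2 ↔
        ((w : ℝ) * c + r ≤ 1 ∧ 1 < ((w : ℝ) + 1) * c + r)) := by
  obtain ⟨hc3, hc1⟩ := hc
  have hc0 : 0 < c := by linarith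
  have hvalue : ∀ w : ℕ, (w : ℝ) * c + r ≤ 1 → 1 < ((w : ℝ) + 1) * c + r →
      qvar0 x c r 1 = w * c ^ 2 := fun w h1 h2 =>
    hx.qvar0_one_eq hc3 hr (by linarith) (by push_cast; linarith)
  obtain ⟨v, hv2, hv⟩ : ∃ v : ℕ, v ≤ 2 ∧ (v : ℝ) * c + r ≤ 1 ∧ 1 < ((v : ℝ) + 1) * c + r := by
    by_cases h1 : c + r ≤ 1
    · by_cases h2 : 2 * c + r ≤ 1
      · exact ⟨2, le_rfl, by push_cast; linarith, by push_cast; linarith [hr.1]⟩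
      · exact ⟨1, by norm_num, by push_cast; linarith, by push_cast; linarith⟩
    · exact ⟨0, by norm_num, by push_cast; linarith [hr.2], by push_cast; linarith⟩
  have hq := hvalue v hv.1 hv.2
  refine ⟨?_, fun w _ => ⟨fun h => ?_, fun h => hvalue w h.1 h.2⟩⟩
  · rw [hq]
    interval_cases v <;> simp
  · have hvw : (v : ℝ) = w := mul_right_cancel₀ (pow_ne_zero 2 hc0.ne') (hq.symm.trans h)
    rwa [← hvw]
end
end
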